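/- arXiv:2212.07101 — 3 statements merged into one kernel-verified Lean document; each statement's English description precedes it below -/
import Mathlib

section
/- Any two elements of the convex hull of a finite family of distributions are at H-divergence at most the maximum pairwise H-divergence of the family: let μ_1, …, μ_N be probability measures on a measurable space X, let π_1, …, π_N and π'_1, …, π'_N be nonnegative reals each summing to 1, and let H be a nonempty hypothesis class of measurable functions h : X → Bool. Then d_H(Σ_{i=1}^N π_i μ_i, Σ_{j=1}^N π'_j μ_j) ≤ max_{1 ≤ i, j ≤ N} d_H(μ_i, μ_j). -/
open MeasureTheory

/-- The `H`-divergence between two measures, for a hypothesis class `H` of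
Boolean-valued classifiers: `d_H(μ, ν) = 2 ⬝ sup_{h ∈ H} |μ(h⁻¹{true}) − ν(h⁻¹{true})|`. -/
noncomputable def Hdiv {X : Type*} [MeasurableSpace X] (H : Set (X → Bool))
    (μ ν : Measure X) : ℝ :=
  2 * sSup ((fun h : X → Bool =>
    |(μ (h ⁻¹' {true})).toReal - (ν (h ⁻¹' {true})).toReal|) '' H)

/-- Each hypothesis witnesses a lower bound for the `H`-divergence of probability measures. -/
lemma two_mul_abs_sub_le_Hdiv {X : Type*} [MeasurableSpace X] {H : Set (X → Bool)}
    (μ ν : Measure X) [IsProbabilityMeasure μ] [IsProbabilityMeasure ν]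
    {h : X → Bool} (hh : h ∈ H) :
    2 * |(μ (h ⁻¹' {true})).toReal - (ν (h ⁻¹' {true})).toReal| ≤ Hdiv H μ ν := by
  refine mul_le_mul_of_nonneg_left (le_csSup ⟨1, ?_⟩ ⟨h, hh, rfl⟩) zero_le_two
  rintro _ ⟨g, -, rfl⟩
  have hμ : (μ (g ⁻¹' {true})).toReal ≤ 1 := measureReal_le_one
  have hν : (ν (g ⁻¹' {true})).toReal ≤ 1 := measureReal_le_one
  have hμ₀ : 0 ≤ (μ (g ⁻¹' {true})).toReal := ENNReal.toReal_nonneg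
  have hν₀ : 0 ≤ (ν (g ⁻¹' {true})).toReal := ENNReal.toReal_nonneg
  exact abs_sub_le_iff.mpr ⟨by linarith, by linarith⟩

/-- The measure of a set under a finite mixture is the weighted sum of its measures. -/
lemma toReal_sum_ofReal_smul_apply {X ι : Type*} [MeasurableSpace X] [Fintype ι]
    (μ : ι → Measure X) [∀ i, IsFiniteMeasure (μ i)] {w : ι → ℝ} (hw : ∀ i, 0 ≤ w i)
    (s : Set X) :
    ((∑ i, ENNReal.ofReal (w i) • μ i) s).toReal = ∑ i, w i * (μ i s).toReal := by
  rw [Measure.finsetSum_apply, ENNReal.toReal_sum]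
  · simp [ENNReal.toReal_ofReal (hw _)]
  · intro i _
    exact ENNReal.mul_ne_top ENNReal.ofReal_ne_top (measure_ne_top _ _)

/-- Two weighted averages of a finite family differ by at most any bound on the pairwise
differences of the family. -/
lemma abs_weighted_sum_sub_le {ι : Type*} [Fintype ι] {w v : ι → ℝ}
    (hw : ∀ i, 0 ≤ w i) (hw₁ : ∑ i, w i = 1) (hv : ∀ i, 0 ≤ v i) (hv₁ : ∑ i, v i = 1)
    (a : ι → ℝ) {C : ℝ} (hC : ∀ i j, |a i - a j| ≤ C) :
    |∑ i, w i * a i - ∑ j, v j * a j| ≤ C := by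
  have h₁ : ∀ i, |a i - ∑ j, v j * a j| ≤ C := fun i => by
    calc |a i - ∑ j, v j * a j| = |∑ j, v j * (a i - a j)| := by
          simp [mul_sub, Finset.sum_sub_distrib, ← Finset.sum_mul, hv₁]
      _ ≤ ∑ j, |v j * (a i - a j)| := Finset.abs_sum_le_sum_abs _ _
      _ ≤ ∑ j, v j * C := Finset.sum_le_sum fun j _ => by
          rw [abs_mul, abs_of_nonneg (hv j)]
          exact mul_le_mul_of_nonneg_left (hC i j) (hv j)
      _ = C := by rw [← Finset.sum_mul, hv₁, one_mul]
  calc |∑ i, w i * a i - ∑ j, v j * a j| = |∑ i, w i * (a i - ∑ j, v j * a j)| := by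
        simp only [mul_sub, Finset.sum_sub_distrib, ← Finset.sum_mul, hw₁, one_mul]
    _ ≤ ∑ i, |w i * (a i - ∑ j, v j * a j)| := Finset.abs_sum_le_sum_abs _ _
    _ ≤ ∑ i, w i * C := Finset.sum_le_sum fun i _ => by
        rw [abs_mul, abs_of_nonneg (hw i)]
        exact mul_le_mul_of_nonneg_left (h₁ i) (hw i)
    _ = C := by rw [← Finset.sum_mul, hw₁, one_mul]

/-- Any two elements of the convex hull of a finite family of distributions are at
`H`-divergence at most the maximum pairwise `H`-divergence of the family. -/
theorem hdiv_mixtures_le_max_pairwise {X : Type*} [MeasurableSpace X] {N : ℕ} (hN : 0 < N)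
    (μ : Fin N → Measure X) [∀ i, IsProbabilityMeasure (μ i)]
    (π π' : Fin N → ℝ)
    (hπ : ∀ i, 0 ≤ π i) (hπsum : ∑ i, π i = 1)
    (hπ' : ∀ i, 0 ≤ π' i) (hπ'sum : ∑ i, π' i = 1)
    (H : Set (X → Bool)) (hH : H.Nonempty) (hHmeas : ∀ h ∈ H, Measurable h) :
    Hdiv H (∑ i, ENNReal.ofReal (π i) • μ i) (∑ j, ENNReal.ofReal (π' j) • μ j) ≤
      Finset.univ.sup'
        (Finset.univ_nonempty_iff.mpr
          (by have := Fin.pos_iff_nonempty.mp hN; exact instNonemptyProd))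
        (fun p : Fin N × Fin N => Hdiv H (μ p.1) (μ p.2)) := by
  rw [Hdiv, ← le_div_iff₀' zero_lt_two]
  refine csSup_le (hH.image _) ?_
  rintro _ ⟨h, hh, rfl⟩
  simp only [toReal_sum_ofReal_smul_apply μ hπ, toReal_sum_ofReal_smul_apply μ hπ']
  refine abs_weighted_sum_sub_le hπ hπsum hπ' hπ'sum _ fun i j => ?_
  rw [le_div_iff₀' zero_lt_two]
  exact (two_mul_abs_sub_le_Hdiv (μ i) (μ j) hh).trans
    (Finset.le_sup' (fun p : Fin N × Fin N => Hdiv H (μ p.1) (μ p.2)) (Finset.mem_univ (i, j)))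
end

section
/- The Proxy A-distance identity: let X be a measurable space, μ, ν probability measures on X, and H a nonempty hypothesis class of measurable functions h : X → Bool that is closed under complementation (for every h ∈ H, the pointwise negation x ↦ ¬(h x) is also in H). Then the H-divergence equals the Proxy A-distance computed from the minimal balanced classification error: d_H(μ, ν) = 2 · (1 − 2 · inf_{h ∈ H} err(h)), where err(h) = (1/2)·μ({x : h x = false}) + (1/2)·ν({x : h x = true}). -/
open MeasureTheory

/-- Balanced classification error in the domain-discrimination task: samples from `μ`
are labeled `true`, samples from `ν` are labeled `false`, each with weight `1/2`:
`err(h) = (1/2)·μ({x : h x = false}) + (1/2)·ν({x : h x = true})`. -/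
noncomputable def balancedErr {X : Type*} [MeasurableSpace X] (μ ν : Measure X)
    (h : X → Bool) : ℝ :=
  (1 / 2) * (μ {x | h x = false}).toReal + (1 / 2) * (ν {x | h x = true}).toReal


/-- The balanced error measures the signed discrepancy of the `true` region. -/
theorem one_sub_two_mul_balancedErr {X : Type*} [MeasurableSpace X] (μ ν : Measure X)
    [IsProbabilityMeasure μ] {h : X → Bool} (hh : Measurable h) :
    1 - 2 * balancedErr μ ν h =
      (μ (h ⁻¹' {true})).toReal - (ν (h ⁻¹' {true})).toReal := by
  have hcompl : {x | h x = false} = (h ⁻¹' {true})ᶜ := by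
    ext x
    simp
  have hμ : (μ {x | h x = false}).toReal = 1 - (μ (h ⁻¹' {true})).toReal := by
    rw [hcompl]
    exact probReal_compl_eq_one_sub (hh (measurableSet_singleton true))
  have hν : {x | h x = true} = h ⁻¹' {true} := rfl
  rw [balancedErr, hμ, hν]
  ring

/-- Complementing a classifier complements its balanced error. -/
theorem balancedErr_not {X : Type*} [MeasurableSpace X] (μ ν : Measure X)
    [IsProbabilityMeasure μ] [IsProbabilityMeasure ν] {h : X → Bool} (hh : Measurable h) :
    balancedErr μ ν (fun x => !(h x)) = 1 - balancedErr μ ν h := by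
  have hμν := one_sub_two_mul_balancedErr μ ν hh
  have hνμ := one_sub_two_mul_balancedErr ν μ hh
  have hswap : balancedErr μ ν (fun x => !(h x)) = balancedErr ν μ h := by
    simp only [balancedErr, Bool.not_eq_false', Bool.not_eq_true']
    ring
  linarith

theorem balancedErr_nonneg {X : Type*} [MeasurableSpace X] (μ ν : Measure X)
    (h : X → Bool) : 0 ≤ balancedErr μ ν h := by
  unfold balancedErr
  positivity

/-- The Proxy A-distance identity: for a hypothesis class closed under
complementation, the `H`-divergence equals `2 (1 − 2 inf_{h ∈ H} err(h))`. -/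
theorem hdiv_eq_proxy_A_distance {X : Type*} [MeasurableSpace X]
    (H : Set (X → Bool)) (hH : H.Nonempty) (hHmeas : ∀ h ∈ H, Measurable h)
    (hcompl : ∀ h ∈ H, (fun x => !(h x)) ∈ H)
    (μ ν : Measure X) [IsProbabilityMeasure μ] [IsProbabilityMeasure ν] :
    Hdiv H μ ν = 2 * (1 - 2 * sInf ((fun h => balancedErr μ ν h) '' H)) := by
  have hbdd : BddBelow ((fun h => balancedErr μ ν h) '' H) :=
    ⟨0, Set.forall_mem_image.2 fun h _ => balancedErr_nonneg μ ν h⟩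
  suffices hsup : IsLUB ((fun h : X → Bool =>
      |(μ (h ⁻¹' {true})).toReal - (ν (h ⁻¹' {true})).toReal|) '' H)
      (1 - 2 * sInf ((fun h => balancedErr μ ν h) '' H)) by
    rw [Hdiv, hsup.csSup_eq (hH.image _)]
  constructor
  · refine Set.forall_mem_image.2 fun h hh => ?_
    have hle := csInf_le hbdd (Set.mem_image_of_mem _ hh)
    have hle_not := csInf_le hbdd (Set.mem_image_of_mem _ (hcompl h hh))
    have hnot := balancedErr_not μ ν (hHmeas h hh)
    rw [← one_sub_two_mul_balancedErr μ ν (hHmeas h hh), abs_le]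
    constructor <;> linarith
  · intro b hb
    have hge : (1 - b) / 2 ≤ sInf ((fun h => balancedErr μ ν h) '' H) := by
      refine le_csInf (hH.image _) (Set.forall_mem_image.2 fun h hh => ?_)
      have hle := hb (Set.mem_image_of_mem _ hh)
      rw [← one_sub_two_mul_balancedErr μ ν (hHmeas h hh)] at hle
      linarith [le_abs_self (1 - 2 * balancedErr μ ν h)]
    linarith
end

section
/- Single-source domain adaptation risk bound: let X be a measurable space, f : X → Bool a measurable true labeling function shared by both domains, and H a nonempty hypothesis class of measurable functions X → Bool such that for all h, h' ∈ H the indicator function x ↦ decide (h x ≠ h' x) of their disagreement set belongs to H. Let μ_t (target) and μ_s (source) be probability measures on X. Then for every h ∈ H, R_{μ_t}(h) ≤ R_{μ_s}(h) + d_H(μ_t, μ_s)/2 + λ, where λ = inf_{h' ∈ H} (R_{μ_t}(h') + R_{μ_s}(h')). -/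
open MeasureTheory

/-- The zero-one risk of a hypothesis `h` with respect to the true labeling `f`
on a measure `μ`: `R_μ(h) = μ({x : h x ≠ f x})`, as a real number. -/
noncomputable def risk {X : Type*} [MeasurableSpace X] (μ : Measure X)
    (f h : X → Bool) : ℝ :=
  (μ {x | h x ≠ f x}).toReal


/-- Measures of disagreement sets satisfy the triangle inequality. -/
theorem toReal_measure_ne_le_add {X Y : Type*} [MeasurableSpace X] (μ : Measure X)
    [IsFiniteMeasure μ] (a b c : X → Y) :
    (μ {x | a x ≠ c x}).toReal ≤ (μ {x | a x ≠ b x}).toReal + (μ {x | b x ≠ c x}).toReal := by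
  have hsub : {x | a x ≠ c x} ⊆ {x | a x ≠ b x} ∪ {x | b x ≠ c x} := by
    intro x hx
    by_contra hcon
    simp only [Set.mem_union, Set.mem_ofPred_eq, not_or, not_not] at hcon
    exact hx (hcon.1.trans hcon.2)
  exact (measureReal_mono (μ := μ) hsub).trans (measureReal_union_le _ _)

/-- On a hypothesis of the class, two probability measures differ by at most half their
`H`-divergence. -/
theorem abs_sub_le_Hdiv_div_two {X : Type*} [MeasurableSpace X] {H : Set (X → Bool)}
    (μ ν : Measure X) [IsProbabilityMeasure μ] [IsProbabilityMeasure ν]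
    {g : X → Bool} (hg : g ∈ H) :
    |(μ (g ⁻¹' {true})).toReal - (ν (g ⁻¹' {true})).toReal| ≤ Hdiv H μ ν / 2 := by
  rw [Hdiv, mul_div_cancel_left₀ _ (two_ne_zero' ℝ)]
  refine le_csSup ⟨1, ?_⟩ (Set.mem_image_of_mem _ hg)
  rintro _ ⟨k, -, rfl⟩
  exact abs_sub_le_of_nonneg_of_le ENNReal.toReal_nonneg measureReal_le_one
    ENNReal.toReal_nonneg measureReal_le_one

/-- Single-source domain adaptation risk bound:
`R_t(h) ≤ R_s(h) + d_H(μ_t, μ_s)/2 + λ` where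
`λ = inf_{h' ∈ H} (R_t(h') + R_s(h'))`. -/
theorem single_source_da_bound {X : Type*} [MeasurableSpace X]
    (f : X → Bool) (hf : Measurable f)
    (H : Set (X → Bool)) (hH : H.Nonempty) (hHmeas : ∀ h ∈ H, Measurable h)
    (hdis : ∀ h ∈ H, ∀ h' ∈ H, (fun x => decide (h x ≠ h' x)) ∈ H)
    (μt μs : Measure X) [IsProbabilityMeasure μt] [IsProbabilityMeasure μs]
    (h : X → Bool) (hh : h ∈ H) :
    risk μt f h ≤ risk μs f h + Hdiv H μt μs / 2 +
      sInf ((fun h' => risk μt f h' + risk μs f h') '' H) := by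
  rw [← sub_le_iff_le_add']
  refine le_csInf (hH.image _) ?_
  rintro _ ⟨h', hh', rfl⟩
  have key := (le_abs_self _).trans (abs_sub_le_Hdiv_div_two μt μs (hdis h hh h' hh'))
  have hset : (fun x => decide (h x ≠ h' x)) ⁻¹' {true} = {x | h x ≠ h' x} := by
    ext x
    simp
  rw [hset] at key
  have ht := toReal_measure_ne_le_add μt h h' f
  have hs := toReal_measure_ne_le_add μs h f h'
  have hcomm : {x | f x ≠ h' x} = {x | h' x ≠ f x} := by
    ext x
    exact ne_comm
  rw [hcomm] at hs
  simp only [risk]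
  linarith
end
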